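/- Let H be a complex Hilbert space, A a bounded normal operator on H whose spectrum contains no negative real number, I a countable index set, and g : I → H a Bessel family. Let L > 0 and suppose {A^t g_i : i ∈ I, t ∈ [0, L]} is a semi-continuous frame for H, i.e., there exist 0 < c ≤ C with c‖f‖² ≤ ∑_{i∈I} ∫₀ᴸ |⟨f, A^t g_i⟩|² dt ≤ C‖f‖² for all f ∈ H. Then there exists δ > 0 such that for every n ≥ 1 and all real numbers 0 = t₁ < t₂ < ⋯ < t_n < L satisfying t_{k+1} − t_k < δ for k = 1, …, n−1 and L − t_n < δ, the finite-time system {A^{t_k} g_i : 1 ≤ k ≤ n, i ∈ I} is a frame for H: there exist 0 < c' ≤ C' with c'‖f‖² ≤ ∑_{i∈I} ∑_{k=1}^n |⟨f, A^{t_k} g_i⟩|² ≤ C'‖f‖² for all f ∈ H. -/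

import Mathlib

open scoped InnerProductSpace

theorem aux_T_norm {H : Type*} [NormedAddCommGroup H] [InnerProductSpace ℂ H] [CompleteSpace H]
    (A : H →L[ℂ] H) (L : ℝ) (hL : 0 < L) :
    ∃ M : ℝ, 1 ≤ M ∧ ∀ t : ℝ, 0 ≤ t → t ≤ L → ‖cfc (fun z : ℂ => z ^ (t : ℂ)) A‖ ≤ M := by
  obtain ⟨R, hR⟩ := (spectrum.isBounded (𝕜 := ℂ) A).exists_norm_le
  have h1 : (1 : ℝ) ≤ max 1 R := le_max_left _ _
  refine ⟨(max 1 R) ^ L, Real.one_le_rpow h1 hL.le, fun t h0 ht => ?_⟩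
  refine norm_cfc_le (by positivity) fun z hz => ?_
  rw [Complex.norm_cpow_real]
  calc ‖z‖ ^ t ≤ (max 1 R) ^ t :=
        Real.rpow_le_rpow (norm_nonneg _) ((hR z hz).trans (le_max_right _ _)) h0
    _ ≤ _ := Real.rpow_le_rpow_of_exponent_le h1 ht

theorem aux_T_cont {H : Type*} [NormedAddCommGroup H] [InnerProductSpace ℂ H] [CompleteSpace H]
    (A : H →L[ℂ] H)
    (hspec : ∀ z ∈ spectrum ℂ A, 0 ≤ z.re ∨ z.im ≠ 0) :
    ContinuousOn (fun t : ℝ => cfc (fun z : ℂ => z ^ (t : ℂ)) A) (Set.Ioi 0) := by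
  have hc : ContinuousOn (fun p : ℝ × ℂ => p.2 ^ (p.1 : ℂ)) (Set.Ioi 0 ×ˢ spectrum ℂ A) := by
    rintro ⟨t, z⟩ ⟨ht, hz⟩
    apply ContinuousAt.continuousWithinAt
    have h := Complex.continuousAt_cpow_of_re_pos (p := (z, (t : ℂ))) (hspec z hz) (by simpa using ht)
    exact ContinuousAt.comp (f := fun p : ℝ × ℂ => (p.2, (p.1 : ℂ))) (x := (t, z)) h (by fun_prop)
  intro t ht
  apply continuousWithinAt_cfc_fun
  · intro u hu
    obtain ⟨v, hv, h⟩ := (spectrum.isCompact (𝕜 := ℂ) A).mem_uniformity_of_prod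
      (f := fun (t : ℝ) (z : ℂ) => z ^ (t : ℂ)) hc ht (UniformSpace.symm hu)
    filter_upwards [hv] with p hp x hx
    exact h p hp x hx
  · filter_upwards [self_mem_nhdsWithin] with s hs
    exact hc.comp (f := fun z => (s, z)) (by fun_prop) (fun z hz => ⟨hs, hz⟩)

open MeasureTheory in
theorem aux_integrable {H : Type*} [NormedAddCommGroup H] [InnerProductSpace ℂ H]
    (T : ℝ → H →L[ℂ] H) (L M : ℝ) (hM : ∀ t, 0 ≤ t → t ≤ L → ‖T t‖ ≤ M)
    (hT : ContinuousOn T (Set.Ioi 0)) (f g : H) :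
    IntegrableOn (fun t => ‖⟪f, T t g⟫_ℂ‖ ^ 2) (Set.Ioc 0 L) := by
  have hc : ContinuousOn (fun t => ‖⟪f, T t g⟫_ℂ‖ ^ 2) (Set.Ioi 0) := by
    have : ContinuousOn (fun t => T t g) (Set.Ioi 0) := hT.clm_apply continuousOn_const
    have := ContinuousOn.inner (𝕜 := ℂ) (continuousOn_const (c := f)) this
    fun_prop
  refine IntegrableOn.of_bound (C := (‖f‖ * (M * ‖g‖)) ^ 2) (by simp)
    ((hc.mono Set.Ioc_subset_Ioi_self).aestronglyMeasurable measurableSet_Ioc) ?_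
  refine (ae_restrict_iff' measurableSet_Ioc).2 (Filter.Eventually.of_forall fun t ht => ?_)
  rw [Real.norm_of_nonneg (by positivity)]
  gcongr
  refine (norm_inner_le_norm _ _).trans ?_
  gcongr
  exact (T t).le_of_opNorm_le (hM t ht.1.le ht.2) g

open MeasureTheory in
/-- The genuine Bessel bound: the lower frame bound forces summability everywhere. -/
theorem aux_bessel {H : Type*} [NormedAddCommGroup H] [InnerProductSpace ℂ H] [CompleteSpace H]
    {I : Type*} [Countable I] (g : I → H)
    (T : ℝ → H →L[ℂ] H) (L M : ℝ) (hL : 0 < L) (hM : ∀ t, 0 ≤ t → t ≤ L → ‖T t‖ ≤ M)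
    (hT : ContinuousOn T (Set.Ioi 0)) (hN : ∀ t, IsStarNormal (T t))
    (CB : ℝ) (hB : ∀ f : H, ∑' i : I, ‖⟪f, g i⟫_ℂ‖ ^ 2 ≤ CB * ‖f‖ ^ 2)
    (c : ℝ) (hc : 0 < c) (hlow : ∀ f : H, c * ‖f‖ ^ 2 ≤
          ∑' i : I, ∫ t in (0 : ℝ)..L, ‖⟪f, T t (g i)⟫_ℂ‖ ^ 2) :
    ∀ (s : Finset I) (f : H), ∑ i ∈ s, ‖⟪f, g i⟫_ℂ‖ ^ 2 ≤ CB * ‖f‖ ^ 2 := by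
  let V : Submodule ℂ H :=
    { carrier := {f | Summable fun i => ‖⟪f, g i⟫_ℂ‖ ^ 2}
      zero_mem' := by simp
      add_mem' := by
        intro a b ha hb
        refine Summable.of_nonneg_of_le (fun i => by positivity) (fun i => ?_)
          ((ha.mul_left 2).add (hb.mul_left 2))
        rw [inner_add_left]
        have h1 := norm_add_le ⟪a, g i⟫_ℂ ⟪b, g i⟫_ℂ
        nlinarith [sq_nonneg (‖⟪a, g i⟫_ℂ‖ - ‖⟪b, g i⟫_ℂ‖), norm_nonneg (⟪a, g i⟫_ℂ + ⟪b, g i⟫_ℂ),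
          norm_nonneg ⟪a, g i⟫_ℂ, norm_nonneg ⟪b, g i⟫_ℂ]
      smul_mem' := by
        intro z a ha
        simp only [Set.mem_setOf_eq, inner_smul_left, norm_mul, mul_pow]
        exact ha.mul_left _ }
  have hVm : ∀ f, f ∈ V ↔ Summable fun i => ‖⟪f, g i⟫_ℂ‖ ^ 2 := fun f => Iff.rfl
  have hVK : ∀ f, f ∈ V ↔ ∀ s : Finset I, ∑ i ∈ s, ‖⟪f, g i⟫_ℂ‖ ^ 2 ≤ CB * ‖f‖ ^ 2 := by
    intro f
    rw [hVm]
    constructor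
    · intro h s
      exact (h.sum_le_tsum s (fun i _ => by positivity)).trans (hB f)
    · intro h
      exact summable_of_sum_le (fun i => by positivity) h
  have hVc : IsClosed (V : Set H) := by
    have : (V : Set H) = ⋂ s : Finset I, {f | ∑ i ∈ s, ‖⟪f, g i⟫_ℂ‖ ^ 2 ≤ CB * ‖f‖ ^ 2} := by
      ext f; simp only [SetLike.mem_coe, hVK, Set.mem_iInter, Set.mem_setOf_eq]
    rw [this]
    refine isClosed_iInter fun s => isClosed_le ?_ ?_ <;> fun_prop
  have hsum : ∀ f : H, Summable fun i => ∫ t in (0 : ℝ)..L, ‖⟪f, T t (g i)⟫_ℂ‖ ^ 2 := by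
    intro f
    by_contra h
    have h1 := hlow f
    rw [tsum_eq_zero_of_not_summable h] at h1
    have h2 : ‖f‖ ^ 2 ≤ 0 := by
      by_contra h3
      push Not at h3
      nlinarith [mul_pos hc h3]
    have h3 : f = 0 := by
      have : ‖f‖ = 0 := by nlinarith [norm_nonneg f]
      simpa using this
    apply h
    simp [h3]
  have hae : ∀ f : H, ∀ᵐ t ∂(volume.restrict (Set.Ioc 0 L)), (T t).adjoint f ∈ V := by
    intro f
    have hi := fun i => aux_integrable T L M hM hT f (g i)
    have h1 : ∫⁻ t in Set.Ioc 0 L, ∑' i, ENNReal.ofReal (‖⟪f, T t (g i)⟫_ℂ‖ ^ 2) ≠ ⊤ := by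
      rw [lintegral_tsum fun i => (hi i).aemeasurable.ennreal_ofReal]
      have : ∀ i, ∫⁻ t in Set.Ioc 0 L, ENNReal.ofReal (‖⟪f, T t (g i)⟫_ℂ‖ ^ 2)
          = ENNReal.ofReal (∫ t in (0 : ℝ)..L, ‖⟪f, T t (g i)⟫_ℂ‖ ^ 2) := by
        intro i
        rw [intervalIntegral.integral_of_le hL.le, ofReal_integral_eq_lintegral_ofReal (hi i)
          (Filter.Eventually.of_forall fun t => by positivity)]
      simp_rw [this]
      exact (hsum f).tsum_ofReal_ne_top
    have h2 := ae_lt_top' (AEMeasurable.tsum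
      fun i => (hi i).aemeasurable.ennreal_ofReal) h1
    filter_upwards [h2] with t ht
    rw [hVm]
    simp_rw [ContinuousLinearMap.adjoint_inner_left]
    have := ENNReal.summable_toReal ht.ne
    refine this.congr fun i => ?_
    rw [ENNReal.toReal_ofReal (by positivity)]
  have hbot : Vᗮ = ⊥ := by
    rw [Submodule.eq_bot_iff]
    intro w hw
    have h1 : ∀ t ∈ Set.Ioo 0 L, T t w = 0 := by
      have h2 : ∀ f : H, Set.EqOn (fun t => ⟪f, T t w⟫_ℂ) (fun _ => 0) (Set.Ioo 0 L) := by
        intro f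
        refine Measure.eqOn_open_of_ae_eq (μ := volume) ?_ isOpen_Ioo ?_ continuousOn_const
        · have := ae_restrict_of_ae_restrict_of_subset (Set.Ioo_subset_Ioc_self) (hae f)
          filter_upwards [this] with t ht
          rw [← ContinuousLinearMap.adjoint_inner_left]
          exact (Submodule.mem_orthogonal _ _).1 hw _ ht
        · have : ContinuousOn (fun t => T t w) (Set.Ioo 0 L) :=
            (hT.mono Set.Ioo_subset_Ioi_self).clm_apply continuousOn_const
          exact ContinuousOn.inner (𝕜 := ℂ) (continuousOn_const (c := f)) this
      intro t ht
      exact inner_self_eq_zero.1 (h2 (T t w) ht)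
    have h3 : ∀ i, ∫ t in (0 : ℝ)..L, ‖⟪w, T t (g i)⟫_ℂ‖ ^ 2 = 0 := by
      intro i
      rw [intervalIntegral.integral_of_le hL.le, integral_Ioc_eq_integral_Ioo]
      refine setIntegral_eq_zero_of_forall_eq_zero fun t ht => ?_
      have h4 : (T t).adjoint w = 0 := by
        rw [← norm_eq_zero, ← ContinuousLinearMap.isStarNormal_iff_norm_eq_adjoint.1 (hN t) w,
          h1 t ht, norm_zero]
      rw [← ContinuousLinearMap.adjoint_inner_left, h4]
      simp
    have h5 := hlow w
    simp only [h3, tsum_zero] at h5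
    have h2 : ‖w‖ ^ 2 ≤ 0 := by
      by_contra h3
      push Not at h3
      nlinarith [mul_pos hc h3]
    have : ‖w‖ = 0 := by nlinarith [norm_nonneg w]
    simpa using this
  have htop : V = ⊤ := by
    haveI : CompleteSpace V := hVc.completeSpace_coe
    exact Submodule.orthogonal_eq_bot_iff.1 hbot
  intro s f
  exact (hVK f).1 (by rw [htop]; trivial) s

/-- The key Riemann-sum estimate for finite subfamilies. -/
theorem aux_riemann {H : Type*} [NormedAddCommGroup H] [InnerProductSpace ℂ H] [CompleteSpace H]
    {I : Type*} (g : I → H)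
    (T : ℝ → H →L[ℂ] H) (L M : ℝ) (hM : ∀ t, 0 ≤ t → t ≤ L → ‖T t‖ ≤ M)
    (hT : ContinuousOn T (Set.Ioi 0)) (CB : ℝ) (hCB : 0 < CB)
    (hB : ∀ (s : Finset I) (f : H), ∑ i ∈ s, ‖⟪f, g i⟫_ℂ‖ ^ 2 ≤ CB * ‖f‖ ^ 2)
    (ε η δ : ℝ) (hε : 0 < ε) (hεL : ε ≤ L) (hη : 0 ≤ η) (hδ : δ ≤ ε / 2)
    (huc : ∀ x ∈ Set.Icc (ε / 2) L, ∀ y ∈ Set.Icc (ε / 2) L, |x - y| < δ → ‖T x - T y‖ ≤ η)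
    (n : ℕ) (τ : ℕ → ℝ) (h0 : τ 0 = 0) (hn : τ n = L) (hmono : Monotone τ)
    (hgap : ∀ k < n, τ (k + 1) - τ k < δ) (s : Finset I) (f : H) :
    ∑ i ∈ s, ∫ t in (0 : ℝ)..L, ‖⟪f, T t (g i)⟫_ℂ‖ ^ 2 ≤
      2 * δ * ∑ k ∈ Finset.range n, ∑ i ∈ s, ‖⟪f, T (τ k) (g i)⟫_ℂ‖ ^ 2 +
        (ε * (CB * M ^ 2) + L * (2 * CB * η ^ 2)) * ‖f‖ ^ 2 := by
  set F : ℝ → ℝ := fun t => ∑ i ∈ s, ‖⟪f, T t (g i)⟫_ℂ‖ ^ 2 with hF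
  have hLpos : 0 ≤ L := by linarith
  have hFnn : ∀ t, 0 ≤ F t := fun t => Finset.sum_nonneg fun i _ => by positivity
  have hint : ∀ i, IntervalIntegrable (fun t => ‖⟪f, T t (g i)⟫_ℂ‖ ^ 2) MeasureTheory.volume 0 L :=
    fun i => (intervalIntegrable_iff_integrableOn_Ioc_of_le hLpos).2
      (aux_integrable T L M hM hT f (g i))
  have hFint : IntervalIntegrable F MeasureTheory.volume 0 L := by
    have := IntervalIntegrable.sum s (fun i _ => hint i)
    refine this.congr fun t _ => ?_
    simp [hF]
  -- bounds on F
  have hnorm : ∀ (S : H →L[ℂ] H) (K : ℝ), ‖S‖ ≤ K →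
      ∑ i ∈ s, ‖⟪f, S (g i)⟫_ℂ‖ ^ 2 ≤ CB * K ^ 2 * ‖f‖ ^ 2 := by
    intro S K hS
    simp_rw [← ContinuousLinearMap.adjoint_inner_left]
    refine (hB s _).trans ?_
    rw [mul_assoc, ← mul_pow]
    gcongr
    refine ContinuousLinearMap.le_of_opNorm_le _ ?_ f
    rwa [LinearIsometryEquiv.norm_map]
  have hFb : ∀ t, 0 ≤ t → t ≤ L → F t ≤ CB * M ^ 2 * ‖f‖ ^ 2 := fun t a b => hnorm _ _ (hM t a b)
  have hFd : ∀ x ∈ Set.Icc (ε / 2) L, ∀ y ∈ Set.Icc (ε / 2) L, |x - y| < δ →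
      F x ≤ 2 * F y + 2 * CB * η ^ 2 * ‖f‖ ^ 2 := by
    intro x hx y hy hxy
    have h1 := hnorm _ _ (huc x hx y hy hxy)
    have h2 : F x ≤ ∑ i ∈ s, (2 * ‖⟪f, T y (g i)⟫_ℂ‖ ^ 2 + 2 * ‖⟪f, (T x - T y) (g i)⟫_ℂ‖ ^ 2) := by
      refine Finset.sum_le_sum fun i _ => ?_
      have h3 : ⟪f, T x (g i)⟫_ℂ = ⟪f, T y (g i)⟫_ℂ + ⟪f, (T x - T y) (g i)⟫_ℂ := by
        rw [← inner_add_right]; simp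
      have h4 := norm_add_le ⟪f, T y (g i)⟫_ℂ ⟪f, (T x - T y) (g i)⟫_ℂ
      rw [← h3] at h4
      nlinarith [sq_nonneg (‖⟪f, T y (g i)⟫_ℂ‖ - ‖⟪f, (T x - T y) (g i)⟫_ℂ‖),
        norm_nonneg ⟪f, T x (g i)⟫_ℂ, norm_nonneg ⟪f, T y (g i)⟫_ℂ,
        norm_nonneg ⟪f, (T x - T y) (g i)⟫_ℂ]
    rw [Finset.sum_add_distrib, ← Finset.mul_sum, ← Finset.mul_sum] at h2
    simp only [hF] at h2 ⊢
    linarith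
  set c1 : ℝ := CB * M ^ 2 * ‖f‖ ^ 2
  set c2 : ℝ := 2 * CB * η ^ 2 * ‖f‖ ^ 2
  have hc1 : 0 ≤ c1 := by positivity
  have hc2 : 0 ≤ c2 := by positivity
  set J : ℝ → ℝ := Set.indicator {x | x ≤ ε} (fun _ => c1) with hJ
  have hJint : ∀ a b, IntervalIntegrable J MeasureTheory.volume a b := by
    intro a b
    have : IntervalIntegrable (fun _ : ℝ => c1) MeasureTheory.volume a b := by simp
    exact ⟨this.1.indicator measurableSet_Iic, this.2.indicator measurableSet_Iic⟩
  have hJI : ∫ t in (0 : ℝ)..L, J t = ε * c1 := by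
    rw [hJ, intervalIntegral.integral_indicator ⟨hε.le, hεL⟩]; simp
  have hτ0 : ∀ k, 0 ≤ τ k := fun k => h0 ▸ hmono (Nat.zero_le k)
  have hτL : ∀ k ≤ n, τ k ≤ L := fun k hk => hn ▸ hmono hk
  have hsub : ∀ k < n, IntervalIntegrable (fun t => F t - J t) MeasureTheory.volume (τ k) (τ (k+1)) := by
    intro k hk
    refine IntervalIntegrable.sub (hFint.mono_set ?_) (hJint _ _)
    rw [Set.uIcc_of_le hLpos, Set.uIcc_of_le (hmono (Nat.le_succ k))]
    exact Set.Icc_subset_Icc (hτ0 k) (hτL _ hk)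
  have hstep : ∀ k < n, ∫ t in (τ k)..(τ (k+1)), (F t - J t) ≤
      2 * δ * F (τ k) + (τ (k+1) - τ k) * c2 := by
    intro k hk
    have hle := hmono (Nat.le_succ k)
    calc ∫ t in (τ k)..(τ (k+1)), (F t - J t)
        ≤ ∫ t in (τ k)..(τ (k+1)), (2 * F (τ k) + c2) := by
          refine intervalIntegral.integral_mono_on hle (hsub k hk) (by simp) fun t ht => ?_
          have ht0 : 0 ≤ t := (hτ0 k).trans ht.1
          have htL : t ≤ L := ht.2.trans (hτL _ hk)
          have hg := hgap k hk
          by_cases hte : t ≤ ε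
          · have : J t = c1 := Set.indicator_of_mem (s := {x | x ≤ ε}) hte _
            rw [this]
            have := hFb t ht0 htL
            linarith [hFnn (τ k)]
          · have : J t = 0 := Set.indicator_of_notMem (s := {x | x ≤ ε}) hte _
            rw [this]
            push Not at hte
            have h1 := ht.1
            have h2 := ht.2
            have := hFd t ⟨by linarith, htL⟩ (τ k) ⟨by linarith, by linarith⟩
              (by rw [abs_of_nonneg (by linarith)]; linarith)
            linarith
      _ = (τ (k+1) - τ k) * (2 * F (τ k)) + (τ (k+1) - τ k) * c2 := by
          simp; ring
      _ ≤ _ := by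
          have := mul_le_mul_of_nonneg_right (hgap k hk).le (hFnn (τ k))
          linarith
  have hsumI : ∑ k ∈ Finset.range n, ∫ t in (τ k)..(τ (k+1)), (F t - J t)
      = ∫ t in (0 : ℝ)..L, (F t - J t) := by
    rw [intervalIntegral.sum_integral_adjacent_intervals hsub, h0, hn]
  have hFJ : ∫ t in (0 : ℝ)..L, (F t - J t) = (∫ t in (0 : ℝ)..L, F t) - ε * c1 := by
    rw [intervalIntegral.integral_sub hFint (hJint _ _), hJI]
  have htot := Finset.sum_le_sum fun k hk => hstep k (Finset.mem_range.1 hk)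
  rw [hsumI, hFJ, Finset.sum_add_distrib, ← Finset.mul_sum, ← Finset.sum_mul,
    Finset.sum_range_sub, h0, hn] at htot
  have hswap : ∑ i ∈ s, ∫ t in (0 : ℝ)..L, ‖⟪f, T t (g i)⟫_ℂ‖ ^ 2 = ∫ t in (0 : ℝ)..L, F t := by
    rw [hF, intervalIntegral.integral_finsetSum fun i _ => hint i]
  rw [hswap]
  have e : (ε * (CB * M ^ 2) + L * (2 * CB * η ^ 2)) * ‖f‖ ^ 2 = ε * c1 + L * c2 := by
    simp only [c1, c2]; ring
  rw [e]
  linarith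

/-- If `(gᵢ)` is Bessel and `{A^t gᵢ : i ∈ I, t ∈ [0,L]}` is a semi-continuous frame for `H`,
then there is `δ > 0` such that every finite time set `0 = t₁ < t₂ < ⋯ < t_n < L` with gaps
(including the final gap up to `L`) smaller than `δ` yields a discrete frame
`{A^{t_k} gᵢ : 1 ≤ k ≤ n, i ∈ I}` for `H`.  (Times are indexed here by `0, …, n-1`.) -/
theorem semicontinuous_frame_discretization
    {H : Type*} [NormedAddCommGroup H] [InnerProductSpace ℂ H] [CompleteSpace H]
    (A : H →L[ℂ] H) (hA : IsStarNormal A)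
    (hspec : ∀ z ∈ spectrum ℂ A, 0 ≤ z.re ∨ z.im ≠ 0)
    {I : Type*} [Countable I] (g : I → H)
    (hbessel : ∃ CB : ℝ, 0 < CB ∧ ∀ f : H, ∑' i : I, ‖⟪f, g i⟫_ℂ‖ ^ 2 ≤ CB * ‖f‖ ^ 2)
    (L : ℝ) (hL : 0 < L)
    (hframe : ∃ c C : ℝ, 0 < c ∧ c ≤ C ∧ ∀ f : H,
      c * ‖f‖ ^ 2 ≤
          ∑' i : I, ∫ t in (0 : ℝ)..L, ‖⟪f, (cfc (fun z : ℂ => z ^ (t : ℂ)) A) (g i)⟫_ℂ‖ ^ 2 ∧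
      ∑' i : I, ∫ t in (0 : ℝ)..L, ‖⟪f, (cfc (fun z : ℂ => z ^ (t : ℂ)) A) (g i)⟫_ℂ‖ ^ 2
          ≤ C * ‖f‖ ^ 2) :
    ∃ δ : ℝ, 0 < δ ∧ ∀ (n : ℕ) (t : ℕ → ℝ), 1 ≤ n → t 0 = 0 →
      (∀ k : ℕ, k + 1 < n → t k < t (k + 1)) → t (n - 1) < L →
      (∀ k : ℕ, k + 1 < n → t (k + 1) - t k < δ) → L - t (n - 1) < δ →
      ∃ c' C' : ℝ, 0 < c' ∧ c' ≤ C' ∧ ∀ f : H,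
        c' * ‖f‖ ^ 2 ≤
            ∑' i : I, ∑ k ∈ Finset.range n,
              ‖⟪f, (cfc (fun z : ℂ => z ^ ((t k : ℝ) : ℂ)) A) (g i)⟫_ℂ‖ ^ 2 ∧
        ∑' i : I, ∑ k ∈ Finset.range n,
            ‖⟪f, (cfc (fun z : ℂ => z ^ ((t k : ℝ) : ℂ)) A) (g i)⟫_ℂ‖ ^ 2 ≤ C' * ‖f‖ ^ 2 := by
  obtain ⟨CB, hCB, hB0⟩ := hbessel
  obtain ⟨c, C, hc, hcC, hfr⟩ := hframe
  obtain ⟨M, hM1, hM⟩ := aux_T_norm A L hL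
  have hT := aux_T_cont A hspec
  have hN : ∀ t : ℝ, IsStarNormal (cfc (fun z : ℂ => z ^ (t : ℂ)) A) := fun t =>
    cfc_predicate _ A
  generalize hTdef : (fun t : ℝ => cfc (fun z : ℂ => z ^ (t : ℂ)) A) = T at hT
  have hTt : ∀ t : ℝ, cfc (fun z : ℂ => z ^ (t : ℂ)) A = T t := fun t => by rw [← hTdef]
  simp only [hTt] at hM hN hfr ⊢
  have hB := aux_bessel g T L M hL hM hT hN CB hB0 c hc (fun f => (hfr f).1)
  have hM0 : 0 < M := by linarith
  set ε : ℝ := min L (c / (4 * (CB * M ^ 2))) with hεd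
  have hε : 0 < ε := lt_min hL (by positivity)
  have hεL : ε ≤ L := min_le_left _ _
  have hε2 : ε * (CB * M ^ 2) ≤ c / 4 := by
    have : ε ≤ c / (4 * (CB * M ^ 2)) := min_le_right _ _
    rw [le_div_iff₀ (by positivity)] at this
    linarith
  set η : ℝ := Real.sqrt (c / (8 * L * CB)) with hηd
  have hη : 0 < η := Real.sqrt_pos.2 (by positivity)
  have hη2 : L * (2 * CB * η ^ 2) = c / 4 := by
    rw [hηd, Real.sq_sqrt (by positivity)]
    field_simp
    norm_num
  have huc := (isCompact_Icc (a := ε / 2) (b := L)).uniformContinuousOn_of_continuous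
    (hT.mono fun x hx => lt_of_lt_of_le (half_pos hε) hx.1)
  obtain ⟨δ0, hδ0, hδ0'⟩ := Metric.uniformContinuousOn_iff.1 huc η hη
  refine ⟨min δ0 (ε / 2), lt_min hδ0 (half_pos hε), ?_⟩
  set δ := min δ0 (ε / 2) with hδd
  have hδ : 0 < δ := lt_min hδ0 (half_pos hε)
  intro n t hn1 ht0 htlt htL htgap htLgap
  let τ : ℕ → ℝ := fun k => if k < n then t k else L
  have hτt : ∀ k < n, τ k = t k := fun k hk => if_pos hk
  have hτL : ∀ k, n ≤ k → τ k = L := fun k hk => if_neg (by omega)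
  have hlast : ∀ k < n, ¬ k + 1 < n → k = n - 1 := fun k _ _ => by omega
  have hmono : Monotone τ := by
    refine monotone_nat_of_le_succ fun k => ?_
    by_cases hk : k < n
    · by_cases hk1 : k + 1 < n
      · rw [hτt k hk, hτt _ hk1]; exact (htlt k hk1).le
      · rw [hτt k hk, hτL _ (by omega), hlast k hk hk1]; exact htL.le
    · rw [hτL _ (by omega), hτL _ (by omega)]
  have hgap : ∀ k < n, τ (k + 1) - τ k < δ := by
    intro k hk
    by_cases hk1 : k + 1 < n
    · rw [hτt k hk, hτt _ hk1]; exact htgap k hk1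
    · rw [hτt k hk, hτL _ (by omega), hlast k hk hk1]; exact htLgap
  have hτ0 : τ 0 = 0 := by rw [hτt 0 (by omega), ht0]
  have hτn : τ n = L := hτL n le_rfl
  have hrie := aux_riemann g T L M hM hT CB hCB hB ε η δ hε hεL hη.le (min_le_right _ _)
    (fun x hx y hy hxy => by
      have := hδ0' x hx y hy (by rw [Real.dist_eq]; exact hxy.trans_le (min_le_left _ _))
      rw [dist_eq_norm] at this
      exact this.le) n τ hτ0 hτn hmono hgap
  have hup : ∀ (f : H) (s : Finset I), ∑ i ∈ s, ∑ k ∈ Finset.range n, ‖⟪f, T (t k) (g i)⟫_ℂ‖ ^ 2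
      ≤ n * (CB * M ^ 2) * ‖f‖ ^ 2 := by
    intro f s
    rw [Finset.sum_comm]
    calc _ ≤ ∑ k ∈ Finset.range n, CB * M ^ 2 * ‖f‖ ^ 2 := by
          refine Finset.sum_le_sum fun k hk => ?_
          rw [Finset.mem_range] at hk
          simp_rw [← ContinuousLinearMap.adjoint_inner_left]
          refine (hB s _).trans ?_
          rw [mul_assoc, ← mul_pow]
          gcongr
          refine ContinuousLinearMap.le_of_opNorm_le _ ?_ f
          rw [LinearIsometryEquiv.norm_map, ← hτt k hk]
          exact hM _ (hτ0 ▸ hmono (Nat.zero_le k)) (hτn ▸ hmono hk.le)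
      _ = _ := by simp; ring
  have hnn : ∀ f : H, 0 ≤ fun i : I => ∑ k ∈ Finset.range n, ‖⟪f, T (t k) (g i)⟫_ℂ‖ ^ 2 :=
    fun f i => Finset.sum_nonneg fun k _ => by positivity
  refine ⟨c / (4 * δ), max (c / (4 * δ)) (n * (CB * M ^ 2)), by positivity, le_max_left _ _,
    fun f => ⟨?_, ?_⟩⟩
  · have hS := summable_of_sum_le (hnn f) (hup f)
    set S := ∑' i : I, ∑ k ∈ Finset.range n, ‖⟪f, T (t k) (g i)⟫_ℂ‖ ^ 2 with hSd
    have h1 : ∑' i : I, ∫ t in (0 : ℝ)..L, ‖⟪f, T t (g i)⟫_ℂ‖ ^ 2 ≤ 2 * δ * S + c / 2 * ‖f‖ ^ 2 := by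
      refine Real.tsum_le_of_sum_le (fun i => ?_) fun s => ?_
      · exact intervalIntegral.integral_nonneg hL.le fun _ _ => by positivity
      · refine (hrie s f).trans ?_
        have h2 : ∑ k ∈ Finset.range n, ∑ i ∈ s, ‖⟪f, T (τ k) (g i)⟫_ℂ‖ ^ 2 ≤ S := by
          have : ∑ k ∈ Finset.range n, ∑ i ∈ s, ‖⟪f, T (τ k) (g i)⟫_ℂ‖ ^ 2
              = ∑ i ∈ s, ∑ k ∈ Finset.range n, ‖⟪f, T (t k) (g i)⟫_ℂ‖ ^ 2 := by
            rw [Finset.sum_comm]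
            refine Finset.sum_congr rfl fun i _ => Finset.sum_congr rfl fun k hk => ?_
            rw [hτt k (Finset.mem_range.1 hk)]
          rw [this]
          exact hS.sum_le_tsum s fun i _ => hnn f i
        have h3 : ε * (CB * M ^ 2) + L * (2 * CB * η ^ 2) ≤ c / 2 := by rw [hη2]; linarith
        gcongr
    have h2 := (hfr f).1.trans h1
    rw [div_mul_eq_mul_div, div_le_iff₀ (by positivity)]
    linarith
  · refine (Real.tsum_le_of_sum_le (hnn f) (hup f)).trans ?_
    gcongr
    exact le_max_right _ _
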